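/- arXiv:2309.11185 — 2 statements merged into one kernel-verified Lean document; each statement's English description precedes it below -/
import Mathlib

section
/- (Fourth-order differential equation for V.) For every τ ∈ [0,1] and every even integer N ≥ 2, the function V satisfies B_4(t)V⁗(t) + B_3(t)V‴(t) + B_2(t)V″(t) + B_1(t)V′(t) + B_0(t)V(t) = 0 for all t ∈ ℝ. -/
open Real MeasureTheory Finset

/-- The rescaled (monic-type) Hermite polynomials `C_k` with parameter `τ`:
`C_0(x) = 1`, `C_1(x) = x`, `C_{k+1}(x) = x·C_k(x) − k·τ·C_{k−1}(x)`. -/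
noncomputable def CH (τ : ℝ) : ℕ → ℝ → ℝ
  | 0 => fun _ => 1
  | 1 => fun x => x
  | (k+2) => fun x => x * CH τ (k+1) x - ((k : ℝ) + 1) * τ * CH τ k x

/-- The elliptic GinUE part `R_N^{(1)}` of the real-eigenvalue density. -/
noncomputable def R1 (τ : ℝ) (N : ℕ) (x : ℝ) : ℝ :=
  (Real.exp (-x^2/(1+τ)) / Real.sqrt (2*Real.pi)) *
    ∑ k ∈ Finset.range (N-1), (CH τ k x)^2 / (Nat.factorial k : ℝ)

/-- The correction part `R_N^{(2)}` of the real-eigenvalue density. -/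
noncomputable def R2 (τ : ℝ) (N : ℕ) (x : ℝ) : ℝ :=
  (1/((1+τ) * (Nat.factorial (N-2) : ℝ))) * (Real.exp (-x^2/(2*(1+τ))) / Real.sqrt (2*Real.pi)) *
    CH τ (N-1) x * (∫ u in (0:ℝ)..x, Real.exp (-u^2/(2*(1+τ))) * CH τ (N-2) u)

/-- The density `R_N` of real eigenvalues of the elliptic GinOE. -/
noncomputable def Rd (τ : ℝ) (N : ℕ) (x : ℝ) : ℝ := R1 τ N x + R2 τ N x

/-- The moment generating function of real eigenvalues of the elliptic GinOE. -/
noncomputable def MGF (τ : ℝ) (N : ℕ) (t : ℝ) : ℝ := ∫ x : ℝ, Real.exp (t*x) * Rd τ N x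

/-- The `p`-th spectral moment of real eigenvalues of the elliptic GinOE. -/
noncomputable def Mom (τ : ℝ) (N : ℕ) (p : ℕ) : ℝ := ∫ x : ℝ, x^p * Rd τ N x

/-- The elliptic GinUE part `u` of the moment generating function. -/
noncomputable def uF (τ : ℝ) (N : ℕ) (t : ℝ) : ℝ := ∫ x : ℝ, Real.exp (t*x) * R1 τ N x

/-- The part `v` of the moment generating function coming from `R_N^{(2)}`. -/
noncomputable def vF (τ : ℝ) (N : ℕ) (t : ℝ) : ℝ := ∫ x : ℝ, Real.exp (t*x) * R2 τ N x

open Polynomial in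
/-- The polynomial `a(t)`. -/
noncomputable def pa (τ Nr : ℝ) : Polynomial ℝ :=
  C (-2*τ^2*(1+τ)^3*(1+2*τ)) * X^6
  + C (4*τ*(1+τ)^2*(1+8*τ-5*τ*(1-τ^2)*Nr)) * X^4
  + C (8*(1-τ^2)*(1-3*τ-30*τ^2+(1-τ^2)*(3+4*τ+4*τ^2)*Nr+2*(1-τ^2)^2*Nr^2)) * X^2
  + C (32*(1-τ)^2*(1+6*τ+2*(1-τ^2)*Nr))

open Polynomial in
/-- The polynomial `b(t)`. -/
noncomputable def pb (τ Nr : ℝ) : Polynomial ℝ :=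
  C (-2*τ*(1+τ)^2*(1-τ-6*τ^2)) * X^5
  + C (4*(1-τ^2)*((1-2*τ)*(1+7*τ)+2*(1-τ)^3*(1+τ)*Nr)) * X^3
  - C (32*(1-τ)^2*(1+6*τ+2*(1-τ^2)*Nr)) * X

open Polynomial in
/-- The polynomial `c(t)`. -/
noncomputable def pc (τ Nr : ℝ) : Polynomial ℝ :=
  C (4*τ*(1-τ^2)*(1+2*τ)) * X^4 - C (8*(1-τ)^2*(1+6*τ+2*Nr*(1-τ^2))) * X^2

open Polynomial in
/-- The polynomial `d(t)`. -/
noncomputable def pd (τ Nr : ℝ) : Polynomial ℝ :=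
  C (τ*(1+τ)*(2+τ)*(1+2*τ)) * X^5 - C (2*(1-τ)*(4+17*τ+6*τ^2+2*Nr*(1-τ^2))) * X^3

open Polynomial in
/-- The polynomial `q(t) = 2τ(1+τ)(4−τ)t² − 4(1−τ)`. -/
noncomputable def pq (τ : ℝ) : Polynomial ℝ :=
  C (2*τ*(1+τ)*(4-τ)) * X^2 - C (4*(1-τ))

open Polynomial in
/-- `t·β_{k,j}(t)`, the numerators (after multiplying by `t`) of the rational functions
`β_{k,j}` from the paper; each is a genuine polynomial. -/
noncomputable def tβ (τ Nr : ℝ) : ℕ → ℕ → Polynomial ℝ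
  | 4, 0 => C (4*(1-τ)) * pc τ Nr * X
  | 3, 0 => C (4*(1-τ)) * (pb τ Nr + C 2 * derivative (pc τ Nr)) * X + pq τ * pc τ Nr
  | 3, 1 => -(C (8*(1-τ)) * pc τ Nr * X)
  | 2, 0 => C (4*(1-τ)) * (pa τ Nr + C 2 * derivative (pb τ Nr)
              + derivative (derivative (pc τ Nr))) * X
            + pq τ * (pb τ Nr + derivative (pc τ Nr)) + C (3*τ^2*(1+τ)^2) * X^3 * pc τ Nr
  | 2, 1 => -(C (8*(1-τ)) * (pb τ Nr + derivative (pc τ Nr)) * X) - pq τ * pc τ Nr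
  | 2, 2 => -(C (4*(1-τ)) * pc τ Nr * X)
  | 2, 3 => C (8*(1-τ)) * pc τ Nr * X
  | 1, 0 => C (4*(1-τ)) * (C 2 * derivative (pa τ Nr)
              + derivative (derivative (pb τ Nr))) * X
            + pq τ * (pa τ Nr + derivative (pb τ Nr)) + C (3*τ^2*(1+τ)^2) * X^3 * pb τ Nr
  | 1, 1 => -(C (8*(1-τ)) * (pa τ Nr + derivative (pb τ Nr)) * X) - pq τ * pb τ Nr
  | 1, 2 => -(C (4*(1-τ)) * pb τ Nr * X)
  | 1, 3 => C (8*(1-τ)) * pb τ Nr * X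
  | 0, 0 => C (4*(1-τ)) * derivative (derivative (pa τ Nr)) * X + pq τ * derivative (pa τ Nr)
            + C (3*τ^2*(1+τ)^2) * X^3 * pa τ Nr - C (4*Nr*τ^2*(1+τ)^5) * X^2 * pd τ Nr
  | 0, 1 => -(C (8*(1-τ)) * derivative (pa τ Nr) * X) - pq τ * pa τ Nr
  | 0, 2 => -(C (4*(1-τ)) * pa τ Nr * X)
  | 0, 3 => C (8*(1-τ)) * pa τ Nr * X
  | _, _ => 0

open Polynomial in
/-- The polynomial `B_k(t) = t⁻⁴(β_{k,0}d² + β_{k,1}dd′ + β_{k,2}dd″ + β_{k,3}d′²)`,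
realised as exact division by `t⁵` of the numerator `t·(…)`. -/
noncomputable def Bpoly (τ Nr : ℝ) (k : ℕ) : Polynomial ℝ :=
  (tβ τ Nr k 0 * (pd τ Nr)^2 + tβ τ Nr k 1 * pd τ Nr * derivative (pd τ Nr)
    + tβ τ Nr k 2 * pd τ Nr * derivative (derivative (pd τ Nr))
    + tβ τ Nr k 3 * (derivative (pd τ Nr))^2) /ₘ X^5

open Polynomial in
/-- The polynomial coefficients `α_{k,j}(t)`. -/
noncomputable def alph (τ Nr : ℝ) : ℕ → ℕ → Polynomial ℝ
  | 7, 4 => C ((1-τ)/2)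
  | 6, 4 => C (-((1+τ)*(τ^2-3*τ+1)/2)) * X
  | 6, 3 => C ((1-τ)/2)
  | 5, 4 => -(C ((1+τ)/2) * (C (2*τ*(1-τ^2)) * X^2 + C ((1-τ^2)*Nr + 5 - 15*τ + 6*τ^2)))
  | 5, 3 => C (-((1+τ)*(τ^2-3*τ+1)/2)) * X
  | 5, 2 => C ((1-τ)/2)
  | 4, 4 => -(C (τ*(1+τ)^2/2) * (C (τ*(1+τ)) * X^2 + C ((1+τ)*Nr + 18 - 19*τ)) * X)
  | 4, 3 => -(C ((1+τ)/2) * (C (2*τ*(1-τ^2)) * X^2 + C ((1-τ^2)*Nr + 4 - 12*τ + 5*τ^2)))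
  | 4, 2 => C (-((1+τ)*(τ^2-3*τ+1)/2)) * X
  | 4, 1 => C ((1-τ)/2)
  | 3, 4 => -(C (2*τ*(1+τ)^2) * (C (3*τ*(1+τ)) * X^2 + C ((1+τ)*Nr + 8 - 9*τ)))
  | 3, 3 => -(C (τ*(1+τ)^2/2) * (C (τ*(1+τ)) * X^2 + C ((1+τ)*Nr + 14 - 15*τ)) * X)
  | 3, 2 => -(C ((1+τ)/2) * (C (2*τ*(1-τ^2)) * X^2 + C ((1-τ^2)*Nr + 3 - 9*τ + 4*τ^2)))
  | 3, 1 => C (-((1+τ)*(τ^2-3*τ+1)/2)) * X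
  | 3, 0 => C ((1-τ)/2)
  | 2, 4 => C (-18*τ^2*(1+τ)^3) * X
  | 2, 3 => -(C (3*τ*(1+τ)^2/2) * (C (3*τ*(1+τ)) * X^2 + C ((1+τ)*Nr + 6 - 7*τ)))
  | 2, 2 => -(C (τ*(1+τ)^2/2) * (C (τ*(1+τ)) * X^2 + C ((1+τ)*Nr + 10 - 11*τ)) * X)
  | 2, 1 => -(C ((1+τ)/2) * (C (2*τ*(1-τ^2)) * X^2 + C ((1-τ^2)*Nr + 2 - 6*τ + 3*τ^2)))
  | 2, 0 => C (-((1+τ)*(τ^2-3*τ+1)/2)) * X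
  | 1, 4 => C (-12*τ^2*(1+τ)^3)
  | 1, 3 => C (-9*τ^2*(1+τ)^3) * X
  | 1, 2 => -(C (τ*(1+τ)^2) * (C (3*τ*(1+τ)) * X^2 + C ((1+τ)*Nr + 4 - 5*τ)))
  | 1, 1 => -(C (τ*(1+τ)^2/2) * (C (τ*(1+τ)) * X^2 + C ((1+τ)*Nr + 6 - 7*τ)) * X)
  | 1, 0 => -(C ((1-τ^2)/2) * (C (2*τ*(1+τ)) * X^2 + C ((1+τ)*Nr + 1 - 2*τ)))
  | 0, 3 => C (-3*τ^2*(1+τ)^3)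
  | 0, 2 => C (-3*τ^2*(1+τ)^3) * X
  | 0, 1 => -(C (τ*(1+τ)^2/2) * (C (3*τ*(1+τ)) * X^2 + C ((1+τ)*Nr + 2 - 3*τ)))
  | 0, 0 => -(C (τ*(1+τ)^2/2) * (C (τ*(1+τ)) * X^2 + C ((1+τ)*Nr + 2 - 3*τ)) * X)
  | _, _ => 0

/-- The polynomial `A_k(t) = Σ_{j=0}^{4} α_{k,j}(t)·B_j(t)`. -/
noncomputable def Apoly (τ Nr : ℝ) (k : ℕ) : Polynomial ℝ :=
  ∑ j ∈ Finset.range 5, alph τ Nr k j * Bpoly τ Nr j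

/-- The auxiliary function `V(t)` built from the moment generating function `M`. -/
noncomputable def VF (τ : ℝ) (N : ℕ) (t : ℝ) : ℝ :=
  ((1-τ)/2) * iteratedDeriv 3 (MGF τ N) t
  - ((1+τ)*(τ^2-3*τ+1)/2) * t * iteratedDeriv 2 (MGF τ N) t
  - ((1-τ^2)/2) * (2*τ*(1+τ)*t^2 + ((N:ℝ)-1)*(1+τ) + 2-τ) * deriv (MGF τ N) t
  - (τ*(1+τ)^2/2) * (τ*(1+τ)*t^2 + ((N:ℝ)-1)*(1+τ) + 3-2*τ) * t * MGF τ N t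

/-- Continuous functions all of whose exponential tilts `x ↦ e^{ax} f(x)` are integrable. -/
structure ExpIntegrable (f : ℝ → ℝ) : Prop where
  continuous : Continuous f
  integrable : ∀ a : ℝ, Integrable (fun x => Real.exp (a * x) * f x)

/-- The two-sided Laplace transform `t ↦ ∫ e^{tx} f(x) dx`. -/
noncomputable def biLaplace (f : ℝ → ℝ) (t : ℝ) : ℝ := ∫ x : ℝ, Real.exp (t * x) * f x

namespace ExpIntegrable

variable {f g : ℝ → ℝ}

theorem add (hf : ExpIntegrable f) (hg : ExpIntegrable g) :
    ExpIntegrable (fun x => f x + g x) :=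
  ⟨hf.continuous.add hg.continuous, fun a => by
    simpa only [mul_add] using (hf.integrable a).fun_add (hg.integrable a)⟩

theorem const_mul (hf : ExpIntegrable f) (c : ℝ) : ExpIntegrable (fun x => c * f x) :=
  ⟨hf.continuous.const_mul c, fun a => by
    simpa only [mul_left_comm] using (hf.integrable a).const_mul c⟩

theorem sub (hf : ExpIntegrable f) (hg : ExpIntegrable g) :
    ExpIntegrable (fun x => f x - g x) := by
  simpa [sub_eq_add_neg] using hf.add (hg.const_mul (-1))

theorem bounded_mul (hf : ExpIntegrable f) (hg : Continuous g) {c : ℝ} (hc : ∀ x, |g x| ≤ c) :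
    ExpIntegrable (fun x => g x * f x) :=
  ⟨hg.mul hf.continuous, fun a => by
    simpa only [mul_left_comm] using
      (hf.integrable a).bdd_mul hg.aestronglyMeasurable (Filter.Eventually.of_forall hc)⟩

theorem abs_mul_exp_le (x : ℝ) {a s : ℝ} (hs : |s - a| ≤ 1) :
    |x| * Real.exp (s * x) ≤ Real.exp ((a + 2) * x) + Real.exp ((a - 2) * x) := by
  have h1 : |x| ≤ Real.exp |x| := (Real.add_one_le_exp |x|).trans' (by linarith)
  have h2 : s * x ≤ a * x + |x| := by
    have : (s - a) * x ≤ 1 * |x| :=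
      (le_abs_self _).trans (abs_mul (s - a) x ▸ mul_le_mul_of_nonneg_right hs (abs_nonneg x))
    linarith
  calc |x| * Real.exp (s * x) ≤ Real.exp |x| * Real.exp (a * x + |x|) := by gcongr
    _ = Real.exp (a * x + 2 * |x|) := by rw [← Real.exp_add]; ring_nf
    _ ≤ _ := by
      rcases abs_cases x with ⟨h, -⟩ | ⟨h, -⟩ <;> rw [h]
      · rw [show a * x + 2 * x = (a + 2) * x by ring]
        linarith [Real.exp_pos ((a - 2) * x)]
      · rw [show a * x + 2 * -x = (a - 2) * x by ring]
        linarith [Real.exp_pos ((a + 2) * x)]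

theorem integrable_bound (hf : ExpIntegrable f) (a : ℝ) :
    Integrable (fun x => (Real.exp ((a + 2) * x) + Real.exp ((a - 2) * x)) * |f x|) := by
  have h := (hf.integrable (a + 2)).norm.fun_add (hf.integrable (a - 2)).norm
  simpa only [norm_mul, Real.norm_eq_abs, Real.abs_exp, ← add_mul] using h

theorem id_mul (hf : ExpIntegrable f) : ExpIntegrable (fun x => x * f x) := by
  have hc := hf.continuous
  refine ⟨by fun_prop, fun a => (hf.integrable_bound a).mono' (by fun_prop) ?_⟩
  refine Filter.Eventually.of_forall fun x => ?_
  rw [Real.norm_eq_abs, abs_mul, abs_mul, Real.abs_exp, ← mul_assoc, mul_comm (Real.exp _)]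
  exact mul_le_mul_of_nonneg_right (abs_mul_exp_le x (by simp)) (abs_nonneg _)

theorem hasDerivAt_biLaplace (hf : ExpIntegrable f) (t : ℝ) :
    HasDerivAt (biLaplace f) (biLaplace (fun x => x * f x) t) t := by
  have hc := hf.continuous
  refine (hasDerivAt_integral_of_dominated_loc_of_deriv_le
    (F := fun s x => Real.exp (s * x) * f x) (F' := fun s x => Real.exp (s * x) * (x * f x))
    (Metric.closedBall_mem_nhds t one_pos) (Filter.Eventually.of_forall fun s => by fun_prop)
    (hf.integrable t) (by fun_prop) (Filter.Eventually.of_forall fun x s hs => ?_)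
    (hf.integrable_bound t) (Filter.Eventually.of_forall fun x s _ => ?_)).2
  · rw [Real.norm_eq_abs, abs_mul, abs_mul, Real.abs_exp, ← mul_assoc, mul_comm (Real.exp _)]
    exact mul_le_mul_of_nonneg_right (abs_mul_exp_le x (by simpa [Real.dist_eq] using hs))
      (abs_nonneg _)
  · simpa [mul_assoc] using (((hasDerivAt_id s).mul_const x).exp).mul_const (f x)

theorem contDiff_biLaplace (hf : ExpIntegrable f) (n : ℕ) : ContDiff ℝ n (biLaplace f) := by
  induction n generalizing f with
  | zero =>
    exact contDiff_zero.2
      (continuous_iff_continuousAt.2 fun t => (hf.hasDerivAt_biLaplace t).continuousAt)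
  | succ n ih =>
    rw [Nat.cast_add, Nat.cast_one, contDiff_succ_iff_deriv]
    refine ⟨fun t => (hf.hasDerivAt_biLaplace t).differentiableAt, by simp, ?_⟩
    rw [show deriv (biLaplace f) = biLaplace (fun x => x * f x) from
      funext fun t => (hf.hasDerivAt_biLaplace t).deriv]
    exact ih hf.id_mul

theorem biLaplace_add (hf : ExpIntegrable f) (hg : ExpIntegrable g) (t : ℝ) :
    biLaplace (fun x => f x + g x) t = biLaplace f t + biLaplace g t := by
  simp only [biLaplace, mul_add]
  exact integral_add (hf.integrable t) (hg.integrable t)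

theorem biLaplace_sub (hf : ExpIntegrable f) (hg : ExpIntegrable g) (t : ℝ) :
    biLaplace (fun x => f x - g x) t = biLaplace f t - biLaplace g t := by
  simp only [biLaplace, mul_sub]
  exact integral_sub (hf.integrable t) (hg.integrable t)

theorem biLaplace_deriv {f' : ℝ → ℝ} (hf : ExpIntegrable f) (hf' : ExpIntegrable f')
    (h : ∀ x, HasDerivAt f (f' x) x) (t : ℝ) : biLaplace f' t = -(t * biLaplace f t) := by
  have hexp : ∀ x : ℝ, HasDerivAt (fun x => Real.exp (t * x)) (t * Real.exp (t * x)) x :=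
    fun x => by simpa [mul_comm] using ((hasDerivAt_id x).const_mul t).exp
  have := integral_mul_deriv_eq_deriv_mul_of_integrable (u := fun x => Real.exp (t * x))
    (u' := fun x => t * Real.exp (t * x)) (fun x _ => hexp x) (fun x _ => h x)
    (hf'.integrable t) (((hf.integrable t).const_mul t).congr
      (Filter.Eventually.of_forall fun x => (mul_assoc _ _ _).symm)) (hf.integrable t)
  simp only [biLaplace]
  rw [this, ← integral_const_mul]
  simp only [mul_assoc]

end ExpIntegrable

theorem biLaplace_const_mul (c : ℝ) (f : ℝ → ℝ) (t : ℝ) :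
    biLaplace (fun x => c * f x) t = c * biLaplace f t := by
  simp only [biLaplace, mul_left_comm _ c]
  exact integral_const_mul c _

theorem expIntegrable_gaussian {c : ℝ} (hc : 0 < c) :
    ExpIntegrable (fun x => Real.exp (-x ^ 2 / c)) := by
  refine ⟨by fun_prop, fun a => ?_⟩
  have h := ((integrable_exp_neg_mul_sq (inv_pos.2 hc)).comp_sub_right (a * c / 2)).const_mul
    (Real.exp (a ^ 2 * c / 4))
  refine h.congr (Filter.Eventually.of_forall fun x => ?_)
  simp only [← Real.exp_add]
  congr 1
  field_simp
  ring

section Hermite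

variable (τ : ℝ)

theorem CH_succ_succ (k : ℕ) (x : ℝ) :
    CH τ (k + 2) x = x * CH τ (k + 1) x - ((k : ℝ) + 1) * τ * CH τ k x := rfl

theorem mul_CH_pred (k : ℕ) (x : ℝ) :
    τ * ((k : ℝ) * CH τ (k - 1) x) = x * CH τ k x - CH τ (k + 1) x := by
  cases k with
  | zero => simp [CH]
  | succ k =>
    rw [CH_succ_succ]
    push_cast
    ring

theorem hasDerivAt_CH (k : ℕ) (x : ℝ) :
    HasDerivAt (CH τ k) ((k : ℝ) * CH τ (k - 1) x) x := by
  induction k using Nat.twoStepInduction with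
  | zero => simpa [CH] using hasDerivAt_const x (1 : ℝ)
  | one => simpa [CH] using hasDerivAt_id' x
  | more k ih1 ih2 =>
    have h := ((hasDerivAt_id' x).mul ih2).sub (ih1.const_mul (((k : ℝ) + 1) * τ))
    refine h.congr_deriv ?_
    have hp := mul_CH_pred τ k x
    simp only [Nat.add_sub_cancel, show k + 2 - 1 = k + 1 by omega]
    push_cast
    linear_combination (-((k : ℝ) + 1)) * hp

theorem ExpIntegrable.CH_mul {f : ℝ → ℝ} (hf : ExpIntegrable f) (k : ℕ) :
    ExpIntegrable (fun x => CH τ k x * f x) := by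
  induction k using Nat.twoStepInduction with
  | zero => simpa [CH] using hf
  | one => simpa [CH] using hf.id_mul
  | more k ih1 ih2 =>
    convert ih2.id_mul.sub (ih1.const_mul (((k : ℝ) + 1) * τ)) using 2 with x
    rw [CH_succ_succ]
    ring

variable {τ}

/-- The derivative of the truncated Mehler sum on the diagonal collapses to its last term. -/
theorem hasDerivAt_sum_CH_sq (hτ : 0 < 1 + τ) (K : ℕ) (x : ℝ) :
    HasDerivAt (fun x => ∑ k ∈ Finset.range (K + 1), (CH τ k x) ^ 2 / (Nat.factorial k : ℝ))
      (2 * x / (1 + τ) * ∑ k ∈ Finset.range (K + 1), (CH τ k x) ^ 2 / (Nat.factorial k : ℝ)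
        - 2 / ((1 + τ) * (Nat.factorial K : ℝ)) * (CH τ (K + 1) x * CH τ K x)) x := by
  induction K with
  | zero =>
    simp only [zero_add, Finset.range_one, Finset.sum_singleton, Nat.factorial_zero, CH]
    refine (hasDerivAt_const x ((1 : ℝ) ^ 2 / ((1 : ℕ) : ℝ))).congr_deriv ?_
    push_cast
    ring
  | succ K ih =>
    simp only [Finset.sum_range_succ (n := K + 1)]
    have h := ih.add (((hasDerivAt_CH τ (K + 1) x).pow 2).div_const
      (Nat.factorial (K + 1) : ℝ))
    refine h.congr_deriv ?_
    have hK : (Nat.factorial K : ℝ) ≠ 0 := by positivity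
    have hK1 : (K : ℝ) + 1 ≠ 0 := by positivity
    rw [CH_succ_succ, Nat.factorial_succ]
    push_cast
    field_simp
    ring

end Hermite

section Densities

/-- The products `C_i C_j` against the squared weight, in the normalisation of `R2 τ (k + 2)`. -/
noncomputable def localDensity (τ : ℝ) (k i j : ℕ) (x : ℝ) : ℝ :=
  1 / ((1 + τ) * (Nat.factorial k : ℝ) * Real.sqrt (2 * Real.pi)) *
    (CH τ i x * (CH τ j x * Real.exp (-x ^ 2 / (1 + τ))))

/-- The primitive of the weighted polynomial `C_k` occurring in `R2 τ (k + 2)`. -/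
noncomputable def weightedPrimitive (τ : ℝ) (k : ℕ) (x : ℝ) : ℝ :=
  ∫ u in (0 : ℝ)..x, Real.exp (-u ^ 2 / (2 * (1 + τ))) * CH τ k u

/-- The weighted polynomial `C_j` times `weightedPrimitive τ k`, in the normalisation of
`R2 τ (k + 2)`. -/
noncomputable def nonlocalDensity (τ : ℝ) (k j : ℕ) (x : ℝ) : ℝ :=
  1 / ((1 + τ) * (Nat.factorial k : ℝ) * Real.sqrt (2 * Real.pi)) *
    (weightedPrimitive τ k x * (CH τ j x * Real.exp (-x ^ 2 / (2 * (1 + τ)))))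

theorem R2_eq_nonlocalDensity (τ : ℝ) (k : ℕ) :
    R2 τ (k + 2) = nonlocalDensity τ k (k + 1) := by
  funext x
  simp only [R2, nonlocalDensity, weightedPrimitive, Nat.add_sub_cancel,
    show k + 2 - 1 = k + 1 by omega, one_div, mul_inv]
  ring

theorem localDensity_comm (τ : ℝ) (k i j : ℕ) : localDensity τ k i j = localDensity τ k j i := by
  funext x
  simp only [localDensity]
  ring

theorem mul_localDensity_pred (τ : ℝ) (k i j : ℕ) (x : ℝ) :
    τ * (j * localDensity τ k i (j - 1) x) =
      x * localDensity τ k i j x - localDensity τ k i (j + 1) x := by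
  simp only [localDensity]
  linear_combination (1 / ((1 + τ) * (Nat.factorial k : ℝ) * Real.sqrt (2 * Real.pi)) *
    CH τ i x * Real.exp (-x ^ 2 / (1 + τ))) * mul_CH_pred τ j x

theorem mul_nonlocalDensity_pred (τ : ℝ) (k j : ℕ) (x : ℝ) :
    τ * (j * nonlocalDensity τ k (j - 1) x) =
      x * nonlocalDensity τ k j x - nonlocalDensity τ k (j + 1) x := by
  simp only [nonlocalDensity]
  linear_combination (1 / ((1 + τ) * (Nat.factorial k : ℝ) * Real.sqrt (2 * Real.pi)) *
    weightedPrimitive τ k x * Real.exp (-x ^ 2 / (2 * (1 + τ)))) * mul_CH_pred τ j x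

theorem hasDerivAt_gaussian (c x : ℝ) :
    HasDerivAt (fun x : ℝ => Real.exp (-x ^ 2 / c)) (Real.exp (-x ^ 2 / c) * (-(2 * x) / c)) x := by
  simpa using (((hasDerivAt_id x).pow 2).neg.div_const c).exp

variable {τ : ℝ}

theorem hasDerivAt_localDensity (k i j : ℕ) (x : ℝ) :
    HasDerivAt (localDensity τ k i j)
      (i * localDensity τ k (i - 1) j x + j * localDensity τ k i (j - 1) x
        - 2 / (1 + τ) * (x * localDensity τ k i j x)) x := by
  refine (((hasDerivAt_CH τ i x).mul ((hasDerivAt_CH τ j x).mul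
    (hasDerivAt_gaussian (1 + τ) x))).const_mul _).congr_deriv ?_
  simp only [localDensity, Pi.mul_apply]
  ring

theorem expIntegrable_localDensity (hτ : 0 < 1 + τ) (k i j : ℕ) :
    ExpIntegrable (localDensity τ k i j) :=
  (((expIntegrable_gaussian hτ).CH_mul τ j).CH_mul τ i).const_mul _

theorem expIntegrable_CH_mul_gaussian (hτ : 0 < 1 + τ) (k : ℕ) :
    ExpIntegrable (fun x => CH τ k x * Real.exp (-x ^ 2 / (2 * (1 + τ)))) :=
  (expIntegrable_gaussian (by positivity)).CH_mul τ k

theorem hasDerivAt_weightedPrimitive (hτ : 0 < 1 + τ) (k : ℕ) (x : ℝ) :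
    HasDerivAt (weightedPrimitive τ k) (Real.exp (-x ^ 2 / (2 * (1 + τ))) * CH τ k x) x := by
  have hc : Continuous (fun u => Real.exp (-u ^ 2 / (2 * (1 + τ))) * CH τ k u) := by
    simpa only [mul_comm] using (expIntegrable_CH_mul_gaussian hτ k).continuous
  exact hc.integral_hasStrictDerivAt 0 x |>.hasDerivAt

theorem abs_weightedPrimitive_le (hτ : 0 < 1 + τ) (k : ℕ) (x : ℝ) :
    |weightedPrimitive τ k x| ≤ ∫ u : ℝ, |Real.exp (-u ^ 2 / (2 * (1 + τ))) * CH τ k u| := by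
  have hi : Integrable (fun u => Real.exp (-u ^ 2 / (2 * (1 + τ))) * CH τ k u) := by
    simpa [mul_comm] using (expIntegrable_CH_mul_gaussian hτ k).integrable 0
  exact intervalIntegral.norm_integral_le_integral_norm_uIoc.trans
    (setIntegral_le_integral hi.norm (Filter.Eventually.of_forall fun _ => norm_nonneg _))

theorem expIntegrable_nonlocalDensity (hτ : 0 < 1 + τ) (k j : ℕ) :
    ExpIntegrable (nonlocalDensity τ k j) :=
  ((expIntegrable_CH_mul_gaussian hτ j).bounded_mul
    (continuous_iff_continuousAt.2 fun x => (hasDerivAt_weightedPrimitive hτ k x).continuousAt)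
    (abs_weightedPrimitive_le hτ k)).const_mul _

theorem hasDerivAt_nonlocalDensity (hτ : 0 < 1 + τ) (k j : ℕ) (x : ℝ) :
    HasDerivAt (nonlocalDensity τ k j)
      (j * nonlocalDensity τ k (j - 1) x + localDensity τ k j k x
        - 1 / (1 + τ) * (x * nonlocalDensity τ k j x)) x := by
  refine (((hasDerivAt_weightedPrimitive hτ k x).mul ((hasDerivAt_CH τ j x).mul
    (hasDerivAt_gaussian (2 * (1 + τ)) x))).const_mul _).congr_deriv ?_
  have h : Real.exp (-x ^ 2 / (1 + τ)) = Real.exp (-x ^ 2 / (2 * (1 + τ))) ^ 2 := by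
    rw [← Real.exp_nat_mul]
    congr 1
    push_cast
    field_simp
  simp only [localDensity, nonlocalDensity, Pi.mul_apply, h]
  field_simp
  ring

theorem hasDerivAt_R1 (hτ : 0 < 1 + τ) (k : ℕ) (x : ℝ) :
    HasDerivAt (R1 τ (k + 2)) (-2 * localDensity τ k (k + 1) k x) x := by
  refine (((hasDerivAt_gaussian (1 + τ) x).div_const _).mul
    (hasDerivAt_sum_CH_sq hτ k x)).congr_deriv ?_
  simp only [localDensity, div_eq_mul_inv, mul_inv]
  ring

theorem expIntegrable_R1 (hτ : 0 < 1 + τ) (N : ℕ) : ExpIntegrable (R1 τ N) := by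
  have hs : ∀ K : ℕ, ExpIntegrable (fun x => ∑ k ∈ Finset.range K,
      1 / (Nat.factorial k : ℝ) * (CH τ k x * (CH τ k x * Real.exp (-x ^ 2 / (1 + τ))))) := by
    intro K
    induction K with
    | zero => simpa using (expIntegrable_gaussian hτ).const_mul 0
    | succ K ih =>
      simp only [Finset.sum_range_succ]
      exact ih.add ((((expIntegrable_gaussian hτ).CH_mul τ K).CH_mul τ K).const_mul _)
  convert (hs (N - 1)).const_mul (1 / Real.sqrt (2 * Real.pi)) using 2 with x
  simp only [R1, Finset.mul_sum]
  exact Finset.sum_congr rfl fun _ _ => by ring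

theorem biLaplace_localDensity_succ (hτ : 0 < 1 + τ) (k i j : ℕ) (t : ℝ) :
    τ * (j * biLaplace (localDensity τ k i (j - 1)) t) =
      biLaplace (fun x => x * localDensity τ k i j x) t
        - biLaplace (localDensity τ k i (j + 1)) t := by
  have hf := expIntegrable_localDensity hτ k i
  rw [← (hf j).id_mul.biLaplace_sub (hf (j + 1)), ← biLaplace_const_mul, ← biLaplace_const_mul]
  simp only [mul_localDensity_pred]

theorem biLaplace_nonlocalDensity_succ (hτ : 0 < 1 + τ) (k j : ℕ) (t : ℝ) :
    τ * (j * biLaplace (nonlocalDensity τ k (j - 1)) t) =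
      biLaplace (fun x => x * nonlocalDensity τ k j x) t
        - biLaplace (nonlocalDensity τ k (j + 1)) t := by
  have hf := expIntegrable_nonlocalDensity hτ k
  rw [← (hf j).id_mul.biLaplace_sub (hf (j + 1)), ← biLaplace_const_mul, ← biLaplace_const_mul]
  simp only [mul_nonlocalDensity_pred]

theorem mul_biLaplace_localDensity (hτ : 0 < 1 + τ) (k i j : ℕ) (t : ℝ) :
    -(t * biLaplace (localDensity τ k i j) t) =
      i * biLaplace (localDensity τ k (i - 1) j) t + j * biLaplace (localDensity τ k i (j - 1)) t
        - 2 / (1 + τ) * biLaplace (fun x => x * localDensity τ k i j x) t := by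
  have hf := expIntegrable_localDensity hτ k
  have h1 := (hf (i - 1) j).const_mul i
  have h2 := (hf i (j - 1)).const_mul j
  have h3 := (hf i j).id_mul.const_mul (2 / (1 + τ))
  rw [← (hf i j).biLaplace_deriv ((h1.add h2).sub h3) (hasDerivAt_localDensity k i j),
    (h1.add h2).biLaplace_sub h3, h1.biLaplace_add h2]
  simp only [biLaplace_const_mul]

theorem mul_biLaplace_nonlocalDensity (hτ : 0 < 1 + τ) (k j : ℕ) (t : ℝ) :
    -(t * biLaplace (nonlocalDensity τ k j) t) =
      j * biLaplace (nonlocalDensity τ k (j - 1)) t + biLaplace (localDensity τ k j k) t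
        - 1 / (1 + τ) * biLaplace (fun x => x * nonlocalDensity τ k j x) t := by
  have hf := expIntegrable_nonlocalDensity hτ k
  have h1 := (hf (j - 1)).const_mul j
  have h2 := expIntegrable_localDensity hτ k j k
  have h3 := (hf j).id_mul.const_mul (1 / (1 + τ))
  rw [← (hf j).biLaplace_deriv ((h1.add h2).sub h3) (hasDerivAt_nonlocalDensity hτ k j),
    (h1.add h2).biLaplace_sub h3, h1.biLaplace_add h2]
  simp only [biLaplace_const_mul]

theorem mul_biLaplace_R1 (hτ : 0 < 1 + τ) (k : ℕ) (t : ℝ) :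
    t * biLaplace (R1 τ (k + 2)) t = 2 * biLaplace (localDensity τ k (k + 1) k) t := by
  have h := (expIntegrable_R1 hτ (k + 2)).biLaplace_deriv
    ((expIntegrable_localDensity hτ k (k + 1) k).const_mul (-2)) (hasDerivAt_R1 hτ k) t
  rw [biLaplace_const_mul] at h
  linarith

theorem MGF_eq_biLaplace_add (hτ : 0 < 1 + τ) (k : ℕ) (t : ℝ) :
    MGF τ (k + 2) t = biLaplace (R1 τ (k + 2)) t + biLaplace (nonlocalDensity τ k (k + 1)) t := by
  rw [← (expIntegrable_R1 hτ (k + 2)).biLaplace_add (expIntegrable_nonlocalDensity hτ k (k + 1)),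
    ← R2_eq_nonlocalDensity]
  rfl

end Densities

section Jets

open Polynomial

theorem HasDerivAt.eq_of_forall_eq {f g : ℝ → ℝ} {f' g' t : ℝ} (hf : HasDerivAt f f' t)
    (hg : HasDerivAt g g' t) (h : ∀ s, f s = g s) : f' = g' :=
  hf.unique ((funext h : f = g) ▸ hg)

theorem HasDerivAt.const_mul_pow_succ_mul {f : ℝ → ℝ} {f' t : ℝ} (hf : HasDerivAt f f' t)
    (c : ℝ) (k : ℕ) :
    HasDerivAt (fun s => c * (s ^ (k + 1) * f s))
      (c * (((k : ℝ) + 1) * t ^ k * f t + t ^ (k + 1) * f')) t := by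
  have h := ((hasDerivAt_pow (k + 1) t).mul hf).const_mul c
  simpa using h

/-- A sequence of functions each of which is the derivative of its predecessor. -/
def IsJet (f : ℕ → ℝ → ℝ) : Prop := ∀ k t, HasDerivAt (f k) (f (k + 1) t) t

theorem IsJet.continuous {f : ℕ → ℝ → ℝ} (hf : IsJet f) (k : ℕ) : Continuous (f k) :=
  continuous_iff_continuousAt.2 fun t => (hf k t).continuousAt

/-- The differential system linking the transforms `u`, `v` of `R1`, `R2` to those of the
auxiliary densities, with `n = N - 1`. -/
structure TransformSystem (τ n : ℝ) (u v y A D : ℕ → ℝ → ℝ) : Prop where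
  jet_u : IsJet u
  jet_v : IsJet v
  jet_y : IsJet y
  jet_A : IsJet A
  jet_D : IsJet D
  eq_u : ∀ t, (1 - τ) * (u 0 t + t * u 1 t) =
    2 * (1 + τ) * A 0 t - (1 + τ) * τ * (t ^ 2 * u 0 t) - 2 * (1 + τ) * n * τ * D 0 t
  eq_v : ∀ t, v 1 t = (1 + τ) * (t * v 0 t + n * y 0 t + 1 / 2 * (t * u 0 t))
  eq_y : ∀ t, y 1 t = (1 + τ) * (v 0 t - τ * (t * y 0 t) - τ * D 0 t)
  eq_A : ∀ t, A 1 t = (1 + τ) / 2 * (t * A 0 t + n * (t * u 0 t))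
  eq_D : ∀ t, D 1 t = (1 + τ) / 2 * (t * u 0 t - τ * (t * D 0 t))

namespace TransformSystem

variable {τ n : ℝ} {u v y A D : ℕ → ℝ → ℝ}

theorem eq_A_deriv (h : TransformSystem τ n u v y A D) (t : ℝ) :
    A 2 t = (1 + τ) / 2 * (A 0 t + t * A 1 t + n * (u 0 t + t * u 1 t)) := by
  have h' := (h.jet_A 1 t).eq_of_forall_eq
    ((((hasDerivAt_id' t).mul (h.jet_A 0 t)).add
      (((hasDerivAt_id' t).mul (h.jet_u 0 t)).const_mul n)).const_mul ((1 + τ) / 2)) h.eq_A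
  linear_combination h'

theorem eq_D_deriv (h : TransformSystem τ n u v y A D) (t : ℝ) :
    D 2 t = (1 + τ) / 2 * (u 0 t + t * u 1 t - τ * (D 0 t + t * D 1 t)) := by
  have h' := (h.jet_D 1 t).eq_of_forall_eq
    ((((hasDerivAt_id' t).mul (h.jet_u 0 t)).sub
      (((hasDerivAt_id' t).mul (h.jet_D 0 t)).const_mul τ)).const_mul ((1 + τ) / 2)) h.eq_D
  linear_combination h'

theorem eq_y_deriv (h : TransformSystem τ n u v y A D) (t : ℝ) :
    y 2 t = (1 + τ) * (v 1 t - τ * (y 0 t + t * y 1 t) - τ * D 1 t) := by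
  have h' := (h.jet_y 1 t).eq_of_forall_eq
    ((((h.jet_v 0 t).sub (((hasDerivAt_id' t).mul (h.jet_y 0 t)).const_mul τ)).sub
      ((h.jet_D 0 t).const_mul τ)).const_mul (1 + τ)) h.eq_y
  linear_combination h'

theorem eq_v_deriv (h : TransformSystem τ n u v y A D) (t : ℝ) :
    v 2 t = (1 + τ) * (v 0 t + t * v 1 t + n * y 1 t + 1 / 2 * (u 0 t + t * u 1 t)) := by
  have h' := (h.jet_v 1 t).eq_of_forall_eq
    (((((hasDerivAt_id' t).mul (h.jet_v 0 t)).add ((h.jet_y 0 t).const_mul n)).add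
      (((hasDerivAt_id' t).mul (h.jet_u 0 t)).const_mul (1 / 2))).const_mul (1 + τ)) h.eq_v
  linear_combination h'

theorem eq_v_deriv_deriv (h : TransformSystem τ n u v y A D) (t : ℝ) :
    v 3 t = (1 + τ) * (2 * v 1 t + t * v 2 t + n * y 2 t + 1 / 2 * (2 * u 1 t + t * u 2 t)) := by
  have h' := (h.jet_v 2 t).eq_of_forall_eq
    (((((h.jet_v 0 t).add ((hasDerivAt_id' t).mul (h.jet_v 1 t))).add
      ((h.jet_y 1 t).const_mul n)).add (((h.jet_u 0 t).add
        ((hasDerivAt_id' t).mul (h.jet_u 1 t))).const_mul (1 / 2))).const_mul (1 + τ)) h.eq_v_deriv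
  linear_combination h'

theorem eq_u_deriv (h : TransformSystem τ n u v y A D) (t : ℝ) :
    (1 - τ) * (2 * u 1 t + t * u 2 t) =
      2 * (1 + τ) * A 1 t - (1 + τ) * τ * (2 * (t * u 0 t) + t ^ 2 * u 1 t)
        - 2 * (1 + τ) * n * τ * D 1 t := by
  have h' := (((h.jet_u 0 t).add ((hasDerivAt_id' t).mul (h.jet_u 1 t))).const_mul
    (1 - τ)).eq_of_forall_eq ((((h.jet_A 0 t).const_mul (2 * (1 + τ))).sub
      ((h.jet_u 0 t).const_mul_pow_succ_mul ((1 + τ) * τ) 1)).sub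
      ((h.jet_D 0 t).const_mul (2 * (1 + τ) * n * τ))) h.eq_u
  push_cast at h'
  linear_combination h'

theorem eq_u_deriv_deriv (h : TransformSystem τ n u v y A D) (t : ℝ) :
    (1 - τ) * (3 * u 2 t + t * u 3 t) =
      2 * (1 + τ) * A 2 t - (1 + τ) * τ * (2 * u 0 t + 4 * (t * u 1 t) + t ^ 2 * u 2 t)
        - 2 * (1 + τ) * n * τ * D 2 t := by
  have h' := ((((h.jet_u 1 t).const_mul 2).add ((hasDerivAt_id' t).mul (h.jet_u 2 t))).const_mul
    (1 - τ)).eq_of_forall_eq ((((h.jet_A 1 t).const_mul (2 * (1 + τ))).sub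
      (((((hasDerivAt_id' t).mul (h.jet_u 0 t)).const_mul 2).add
        (((hasDerivAt_pow 2 t)).mul (h.jet_u 1 t))).const_mul ((1 + τ) * τ))).sub
      ((h.jet_D 1 t).const_mul (2 * (1 + τ) * n * τ))) h.eq_u_deriv
  push_cast at h'
  linear_combination h'

/-- The third-order differential equation for the transform of `R1`. -/
theorem third_order_u (h : TransformSystem τ n u v y A D) (t : ℝ) :
    (1 - τ) * (t ^ 2 * u 3 t) - (1 + τ) * (τ ^ 2 - 4 * τ + 1) / 2 * (t ^ 3 * u 2 t)
      + 2 * (1 - τ) * (t ^ 1 * u 2 t) - 3 / 4 * τ * (1 - τ) * (1 + τ) ^ 2 * (t ^ 4 * u 1 t)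
      + (τ * (1 + τ) * (5 - 2 * τ) - (n + 1) * (1 - τ) * (1 + τ) ^ 2) * (t ^ 2 * u 1 t)
      - 2 * (1 - τ) * u 1 t - 1 / 4 * τ ^ 2 * (1 + τ) ^ 3 * (t ^ 5 * u 0 t)
      + (τ * (1 + τ) ^ 2 * (9 * τ - 1) / 4 - (n + 1) * τ * (1 + τ) ^ 3) * (t ^ 3 * u 0 t) = 0 := by
  have h2 := h.eq_u_deriv_deriv t
  have h1 := h.eq_u_deriv t
  rw [h.eq_A_deriv, h.eq_D_deriv, h.eq_A, h.eq_D] at h2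
  rw [h.eq_A, h.eq_D] at h1
  linear_combination t * h2 + ((τ ^ 2 - 1) / 2 * t ^ 2 - 1) * h1
    - τ * (1 + τ) ^ 2 / 4 * t ^ 3 * h.eq_u t

theorem fourth_order_u (h : TransformSystem τ n u v y A D) (t : ℝ) :
    (1 - τ) * (2 * t * u 3 t + t ^ 2 * u 4 t)
      - (1 + τ) * (τ ^ 2 - 4 * τ + 1) / 2 * (3 * t ^ 2 * u 2 t + t ^ 3 * u 3 t)
      + 2 * (1 - τ) * (u 2 t + t * u 3 t)
      - 3 / 4 * τ * (1 - τ) * (1 + τ) ^ 2 * (4 * t ^ 3 * u 1 t + t ^ 4 * u 2 t)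
      + (τ * (1 + τ) * (5 - 2 * τ) - (n + 1) * (1 - τ) * (1 + τ) ^ 2) *
        (2 * t * u 1 t + t ^ 2 * u 2 t)
      - 2 * (1 - τ) * u 2 t
      - 1 / 4 * τ ^ 2 * (1 + τ) ^ 3 * (5 * t ^ 4 * u 0 t + t ^ 5 * u 1 t)
      + (τ * (1 + τ) ^ 2 * (9 * τ - 1) / 4 - (n + 1) * τ * (1 + τ) ^ 3) *
        (3 * t ^ 2 * u 0 t + t ^ 3 * u 1 t) = 0 := by
  have hu := fun k => h.jet_u k t
  have h' := HasDerivAt.eq_of_forall_eq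
    ((((((((hu 3).const_mul_pow_succ_mul _ 1).sub ((hu 2).const_mul_pow_succ_mul _ 2)).add
      ((hu 2).const_mul_pow_succ_mul _ 0)).sub ((hu 1).const_mul_pow_succ_mul _ 3)).add
      ((hu 1).const_mul_pow_succ_mul _ 1)).sub ((hu 1).const_mul _)).sub
      ((hu 0).const_mul_pow_succ_mul _ 4) |>.add ((hu 0).const_mul_pow_succ_mul _ 2))
    (hasDerivAt_const t (0 : ℝ)) h.third_order_u
  push_cast at h'
  linear_combination h'

/-- The third-order operator defining `VF` turns `u + v` into a second-order expression in `u`. -/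
theorem operator_eq (h : TransformSystem τ n u v y A D) (t : ℝ) :
    4 * (t ^ 2 * ((1 - τ) / 2 * (u 3 t + v 3 t)
      - (1 + τ) * (τ ^ 2 - 3 * τ + 1) / 2 * t * (u 2 t + v 2 t)
      - (1 - τ ^ 2) / 2 * (2 * τ * (1 + τ) * t ^ 2 + n * (1 + τ) + 2 - τ) * (u 1 t + v 1 t)
      - τ * (1 + τ) ^ 2 / 2 * (τ * (1 + τ) * t ^ 2 + n * (1 + τ) + 3 - 2 * τ) * t *
        (u 0 t + v 0 t)))
    + 4 * (1 - τ) * (t ^ 1 * u 2 t) + 2 * τ * (1 + τ) * (4 - τ) * (t ^ 2 * u 1 t)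
    - 4 * (1 - τ) * u 1 t + 3 * τ ^ 2 * (1 + τ) ^ 2 * (t ^ 3 * u 0 t) = 0 := by
  have h2 := h.eq_u_deriv_deriv t
  have h1 := h.eq_u_deriv t
  rw [h.eq_A_deriv, h.eq_D_deriv, h.eq_A, h.eq_D] at h2
  rw [h.eq_A, h.eq_D] at h1
  rw [h.eq_v_deriv_deriv, h.eq_v_deriv, h.eq_y_deriv, h.eq_v, h.eq_y, h.eq_D]
  linear_combination 2 * t * h2 + ((2 * τ ^ 2 + τ - 1) * t ^ 2 - 2) * h1
    - τ * (1 + τ) ^ 2 * t ^ 3 * h.eq_u t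

end TransformSystem

end Jets

section Smoothness

theorem ContDiff.isJet_iteratedDeriv {f : ℝ → ℝ} (hf : ∀ n : ℕ, ContDiff ℝ n f) :
    IsJet fun k => iteratedDeriv k f := by
  intro k t
  have h := (hf (k + 1)).differentiable_iteratedDeriv k (by exact_mod_cast k.lt_succ_self)
  simpa only [iteratedDeriv_succ] using (h t).hasDerivAt

theorem iteratedDeriv_one_biLaplace {f : ℝ → ℝ} (hf : ExpIntegrable f) (t : ℝ) :
    iteratedDeriv 1 (biLaplace f) t = biLaplace (fun x => x * f x) t := by
  rw [iteratedDeriv_one, (hf.hasDerivAt_biLaplace t).deriv]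

variable {τ : ℝ}

theorem transformSystem_biLaplace (hτ : 0 < 1 + τ) (k : ℕ) :
    TransformSystem τ ((k : ℝ) + 1) (fun j => iteratedDeriv j (biLaplace (R1 τ (k + 2))))
      (fun j => iteratedDeriv j (biLaplace (nonlocalDensity τ k (k + 1))))
      (fun j => iteratedDeriv j (biLaplace (nonlocalDensity τ k k)))
      (fun j => iteratedDeriv j (biLaplace (localDensity τ k (k + 1) (k + 1))))
      (fun j => iteratedDeriv j (biLaplace (localDensity τ k k k))) := by
  have hF := expIntegrable_localDensity hτ k
  have hG := expIntegrable_nonlocalDensity hτ k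
  have hR := expIntegrable_R1 hτ (k + 2)
  have hτ' := hτ.ne'
  refine ⟨ContDiff.isJet_iteratedDeriv hR.contDiff_biLaplace,
    ContDiff.isJet_iteratedDeriv (hG _).contDiff_biLaplace,
    ContDiff.isJet_iteratedDeriv (hG _).contDiff_biLaplace,
    ContDiff.isJet_iteratedDeriv (hF _ _).contDiff_biLaplace,
    ContDiff.isJet_iteratedDeriv (hF _ _).contDiff_biLaplace, ?_, ?_, ?_, ?_, ?_⟩ <;> intro t
  · have hu := mul_biLaplace_R1 hτ k
    have hu' := ((hasDerivAt_id' t).mul (hR.hasDerivAt_biLaplace t)).eq_of_forall_eq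
      (((hF (k + 1) k).hasDerivAt_biLaplace t).const_mul 2) hu
    have h1 := mul_biLaplace_localDensity hτ k (k + 1) k t
    have h2 := biLaplace_localDensity_succ hτ k (k + 1) k t
    simp only [iteratedDeriv_zero, iteratedDeriv_one_biLaplace hR]
    rw [Nat.add_sub_cancel] at h1
    push_cast at h1
    field_simp at h1
    linear_combination (1 - τ) * hu' + τ * (1 + τ) * t * hu t - 2 * τ * h1 - 2 * (1 + τ) * h2
  · have h1 := mul_biLaplace_nonlocalDensity hτ k (k + 1) t
    simp only [iteratedDeriv_zero, iteratedDeriv_one_biLaplace (hG _)]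
    rw [Nat.add_sub_cancel] at h1
    push_cast at h1
    field_simp at h1
    linear_combination h1 - (1 + τ) / 2 * mul_biLaplace_R1 hτ k t
  · have h1 := mul_biLaplace_nonlocalDensity hτ k k t
    have h2 := biLaplace_nonlocalDensity_succ hτ k k t
    simp only [iteratedDeriv_zero, iteratedDeriv_one_biLaplace (hG _)]
    field_simp at h1
    linear_combination -τ * h1 - (1 + τ) * h2
  · have h1 := mul_biLaplace_localDensity hτ k (k + 1) (k + 1) t
    simp only [iteratedDeriv_zero, iteratedDeriv_one_biLaplace (hF _ _)]
    rw [Nat.add_sub_cancel, localDensity_comm τ k k (k + 1)] at h1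
    push_cast at h1
    field_simp at h1
    linear_combination h1 / 2 - (1 + τ) / 2 * (k + 1) * mul_biLaplace_R1 hτ k t
  · have h1 := mul_biLaplace_localDensity hτ k k k t
    have h2 := biLaplace_localDensity_succ hτ k k k t
    simp only [iteratedDeriv_zero, iteratedDeriv_one_biLaplace (hF _ _)]
    rw [localDensity_comm τ k (k - 1) k] at h1
    rw [localDensity_comm τ k k (k + 1)] at h2
    field_simp at h1
    linear_combination -τ / 2 * h1 - (1 + τ) * h2 - (1 + τ) / 2 * mul_biLaplace_R1 hτ k t

theorem iteratedDeriv_MGF (hτ : 0 < 1 + τ) (k j : ℕ) (t : ℝ) :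
    iteratedDeriv j (MGF τ (k + 2)) t = iteratedDeriv j (biLaplace (R1 τ (k + 2))) t
      + iteratedDeriv j (biLaplace (nonlocalDensity τ k (k + 1))) t := by
  rw [show MGF τ (k + 2) = biLaplace (R1 τ (k + 2)) + biLaplace (nonlocalDensity τ k (k + 1)) from
    funext (MGF_eq_biLaplace_add hτ k)]
  exact iteratedDeriv_add ((expIntegrable_R1 hτ _).contDiff_biLaplace j).contDiffAt
    ((expIntegrable_nonlocalDensity hτ k _).contDiff_biLaplace j).contDiffAt

theorem contDiff_iteratedDeriv_MGF (hτ : 0 < 1 + τ) (k j n : ℕ) :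
    ContDiff ℝ n (iteratedDeriv j (MGF τ (k + 2))) := by
  have hM : ContDiff ℝ (n + j : ℕ) (MGF τ (k + 2)) := by
    rw [show MGF τ (k + 2) = fun t => _ from funext (MGF_eq_biLaplace_add hτ k)]
    exact ((expIntegrable_R1 hτ _).contDiff_biLaplace _).add
      ((expIntegrable_nonlocalDensity hτ k _).contDiff_biLaplace _)
  rw [iteratedDeriv_eq_iterate]
  exact ContDiff.iterate_deriv' n j (by exact_mod_cast hM)

theorem contDiff_VF (hτ : 0 < 1 + τ) (k n : ℕ) : ContDiff ℝ n (VF τ (k + 2)) := by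
  have h := fun j => contDiff_iteratedDeriv_MGF hτ k j n
  have h0 := h 0
  have h1 := h 1
  have h2 := h 2
  have h3 := h 3
  rw [iteratedDeriv_zero] at h0
  rw [iteratedDeriv_one] at h1
  unfold VF
  fun_prop

/-- `VF` as a second-order expression in the transform of `R1`. -/
theorem VF_relation (hτ : 0 < 1 + τ) (k : ℕ) (t : ℝ) :
    4 * (t ^ 2 * iteratedDeriv 0 (VF τ (k + 2)) t)
      + 4 * (1 - τ) * (t ^ 1 * iteratedDeriv 2 (biLaplace (R1 τ (k + 2))) t)
      + 2 * τ * (1 + τ) * (4 - τ) * (t ^ 2 * iteratedDeriv 1 (biLaplace (R1 τ (k + 2))) t)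
      - 4 * (1 - τ) * iteratedDeriv 1 (biLaplace (R1 τ (k + 2))) t
      + 3 * τ ^ 2 * (1 + τ) ^ 2 * (t ^ 3 * iteratedDeriv 0 (biLaplace (R1 τ (k + 2))) t) = 0 := by
  have h := (transformSystem_biLaplace hτ k).operator_eq t
  simp only [← iteratedDeriv_MGF hτ] at h
  simp only [iteratedDeriv_zero, iteratedDeriv_one] at h
  simp only [iteratedDeriv_zero, iteratedDeriv_one, VF]
  push_cast
  linear_combination h

end Smoothness

section Elimination

open Polynomial

theorem eq_zero_of_forall_ne_zero {f : ℝ → ℝ} (hf : Continuous f) (h : ∀ t, t ≠ 0 → f t = 0)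
    (t : ℝ) : f t = 0 :=
  congrFun (hf.ext_on (dense_compl_singleton (0 : ℝ)) continuous_const h) t

/-- Multiplying an exact quotient by `X ^ 5` back. -/
theorem pow_mul_eval_divByMonic {p : ℝ[X]} (hp : X ^ 5 ∣ p) (t : ℝ) :
    t ^ 5 * (p /ₘ X ^ 5).eval t = p.eval t := by
  obtain ⟨q, rfl⟩ := hp
  rw [mul_divByMonic_cancel_left _ (monic_X_pow 5)]
  simp

theorem X_pow_three_dvd_pd (τ Nr : ℝ) : X ^ 3 ∣ pd τ Nr :=
  dvd_sub (Dvd.dvd.mul_left (pow_dvd_pow X (by norm_num)) _) (dvd_mul_left _ _)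

theorem X_pow_dvd_derivative {p : ℝ[X]} {n : ℕ} (h : X ^ (n + 1) ∣ p) :
    X ^ n ∣ derivative p := by
  obtain ⟨q, rfl⟩ := h
  rw [derivative_mul, derivative_X_pow, Nat.add_sub_cancel]
  exact dvd_add (Dvd.dvd.mul_right (dvd_mul_left _ _) _)
    (Dvd.dvd.mul_right (pow_dvd_pow X n.le_succ) _)

theorem X_dvd_tβ_two (τ Nr : ℝ) (k : ℕ) : X ∣ tβ τ Nr k 2 := by
  match k with
  | 0 | 1 | 2 => exact dvd_neg.2 (dvd_mul_left _ _)
  | 3 | 4 | _ + 5 => exact dvd_zero _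

theorem X_dvd_tβ_three (τ Nr : ℝ) (k : ℕ) : X ∣ tβ τ Nr k 3 := by
  match k with
  | 0 | 1 | 2 => exact dvd_mul_left _ _
  | 3 | 4 | _ + 5 => exact dvd_zero _

theorem pow_mul_eval_Bpoly (τ Nr : ℝ) (k : ℕ) (t : ℝ) :
    t ^ 5 * (Bpoly τ Nr k).eval t =
      (tβ τ Nr k 0).eval t * (pd τ Nr).eval t ^ 2
      + (tβ τ Nr k 1).eval t * (pd τ Nr).eval t * (derivative (pd τ Nr)).eval t
      + (tβ τ Nr k 2).eval t * (pd τ Nr).eval t * (derivative (derivative (pd τ Nr))).eval t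
      + (tβ τ Nr k 3).eval t * (derivative (pd τ Nr)).eval t ^ 2 := by
  have h0 := X_pow_three_dvd_pd τ Nr
  have h1 : X ^ 2 ∣ derivative (pd τ Nr) := X_pow_dvd_derivative h0
  have h2 : X ^ 1 ∣ derivative (derivative (pd τ Nr)) := X_pow_dvd_derivative h1
  rw [Bpoly, pow_mul_eval_divByMonic]
  · simp only [eval_add, eval_mul, eval_pow]
  refine dvd_add (dvd_add (dvd_add ?_ ?_) ?_) ?_
  · rw [sq, ← mul_assoc]
    exact (pow_dvd_pow X (by norm_num : 5 ≤ 3 + 3)).trans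
      (pow_add (X : ℝ[X]) 3 3 ▸ mul_dvd_mul (h0.mul_left _) h0)
  · exact pow_add (X : ℝ[X]) 3 2 ▸ mul_dvd_mul (h0.mul_left _) h1
  · rw [show (X : ℝ[X]) ^ 5 = X * X ^ 3 * X ^ 1 by ring]
    exact mul_dvd_mul (mul_dvd_mul (X_dvd_tβ_two τ Nr k) h0) h2
  · rw [show (X : ℝ[X]) ^ 5 = X * (X ^ 2) ^ 2 by ring]
    exact mul_dvd_mul (X_dvd_tβ_three τ Nr k) (pow_dvd_pow_of_dvd h1 2)

variable {τ Nr : ℝ} {u V : ℕ → ℝ → ℝ}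

theorem relation_deriv (hu : IsJet u) (hV : IsJet V)
    (hI : ∀ t, 4 * (t ^ 2 * V 0 t) + 4 * (1 - τ) * (t ^ 1 * u 2 t)
      + 2 * τ * (1 + τ) * (4 - τ) * (t ^ 2 * u 1 t) - 4 * (1 - τ) * u 1 t
      + 3 * τ ^ 2 * (1 + τ) ^ 2 * (t ^ 3 * u 0 t) = 0) (t : ℝ) :
    4 * (t ^ 2 * V 1 t) + 8 * (t ^ 1 * V 0 t) + 4 * (1 - τ) * (t ^ 1 * u 3 t)
      + 2 * τ * (1 + τ) * (4 - τ) * (t ^ 2 * u 2 t)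
      + 4 * τ * (1 + τ) * (4 - τ) * (t ^ 1 * u 1 t)
      + 3 * τ ^ 2 * (1 + τ) ^ 2 * (t ^ 3 * u 1 t)
      + 9 * τ ^ 2 * (1 + τ) ^ 2 * (t ^ 2 * u 0 t) = 0 := by
  have h' := HasDerivAt.eq_of_forall_eq
    ((((((hV 0 t).const_mul_pow_succ_mul _ 1).add ((hu 2 t).const_mul_pow_succ_mul _ 0)).add
      ((hu 1 t).const_mul_pow_succ_mul _ 1)).sub ((hu 1 t).const_mul _)).add
      ((hu 0 t).const_mul_pow_succ_mul _ 2)) (hasDerivAt_const t (0 : ℝ)) hI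
  push_cast at h'
  linear_combination h'

theorem relation_deriv_deriv (hu : IsJet u) (hV : IsJet V)
    (hI : ∀ t, 4 * (t ^ 2 * V 0 t) + 4 * (1 - τ) * (t ^ 1 * u 2 t)
      + 2 * τ * (1 + τ) * (4 - τ) * (t ^ 2 * u 1 t) - 4 * (1 - τ) * u 1 t
      + 3 * τ ^ 2 * (1 + τ) ^ 2 * (t ^ 3 * u 0 t) = 0) (t : ℝ) :
    4 * (t ^ 2 * V 2 t) + 16 * (t * V 1 t) + 8 * V 0 t + 4 * (1 - τ) * (u 3 t + t * u 4 t)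
      + 2 * τ * (1 + τ) * (4 - τ) * (t ^ 2 * u 3 t + 4 * (t * u 2 t) + 2 * u 1 t)
      + 3 * τ ^ 2 * (1 + τ) ^ 2 * (t ^ 3 * u 2 t + 6 * (t ^ 2 * u 1 t) + 6 * (t * u 0 t)) = 0 := by
  have h' := HasDerivAt.eq_of_forall_eq
    (((((((hV 1 t).const_mul_pow_succ_mul _ 1).add ((hV 0 t).const_mul_pow_succ_mul _ 0)).add
      ((hu 3 t).const_mul_pow_succ_mul _ 0)).add
      ((hu 2 t).const_mul_pow_succ_mul _ 1)).add ((hu 1 t).const_mul_pow_succ_mul _ 0)).add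
      ((hu 1 t).const_mul_pow_succ_mul _ 2) |>.add ((hu 0 t).const_mul_pow_succ_mul _ 1))
    (hasDerivAt_const t (0 : ℝ)) (relation_deriv hu hV hI)
  push_cast at h'
  linear_combination h'

theorem IsJet.hasDerivAt_eval_mul (hV : IsJet V) (p : ℝ[X]) (k : ℕ) (t : ℝ) :
    HasDerivAt (fun s => p.eval s * V k s)
      ((derivative p).eval t * V k t + p.eval t * V (k + 1) t) t :=
  (p.hasDerivAt t).mul (hV k t)

/-- Eliminating the higher derivatives of `u` expresses `d u` through `V`, `V'` and `V''`. -/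
theorem TransformSystem.combination_V {n : ℝ} {v y A D : ℕ → ℝ → ℝ}
    (h : TransformSystem τ n u v y A D) (hn : n + 1 = Nr) (hV : IsJet V)
    (hI : ∀ t, 4 * (t ^ 2 * V 0 t) + 4 * (1 - τ) * (t ^ 1 * u 2 t)
      + 2 * τ * (1 + τ) * (4 - τ) * (t ^ 2 * u 1 t) - 4 * (1 - τ) * u 1 t
      + 3 * τ ^ 2 * (1 + τ) ^ 2 * (t ^ 3 * u 0 t) = 0) (t : ℝ) :
    (pa τ Nr).eval t * V 0 t + (pb τ Nr).eval t * V 1 t + (pc τ Nr).eval t * V 2 t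
      + Nr * τ ^ 2 * (1 + τ) ^ 5 * ((pd τ Nr).eval t * u 0 t) = 0 := by
  refine eq_zero_of_forall_ne_zero (f := fun t => (pa τ Nr).eval t * V 0 t
    + (pb τ Nr).eval t * V 1 t + (pc τ Nr).eval t * V 2 t
      + Nr * τ ^ 2 * (1 + τ) ^ 5 * ((pd τ Nr).eval t * u 0 t)) ?_ (fun t ht => ?_) t
  · have h0 := hV.continuous 0
    have h1 := hV.continuous 1
    have h2 := hV.continuous 2
    have h3 := h.jet_u.continuous 0
    fun_prop
  have hS := h.third_order_u t
  have hS' := h.fourth_order_u t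
  have hI' := relation_deriv h.jet_u hV hI t
  have hI'' := relation_deriv_deriv h.jet_u hV hI t
  rw [hn] at hS hS'
  refine (mul_eq_zero.1 ?_).resolve_left (pow_ne_zero 4 ht)
  simp only [pa, pb, pc, pd, eval_add, eval_sub, eval_mul, eval_pow, eval_C, eval_X]
  linear_combination
    ((-2*τ^2*(1+τ)^3*(1+2*τ) * t^6 + 4*τ*(1+τ)^2*(1+8*τ-5*τ*(1-τ^2)*Nr) * t^4
      + 8*(1-τ^2)*(1-3*τ-30*τ^2+(1-τ^2)*(3+4*τ+4*τ^2)*Nr+2*(1-τ^2)^2*Nr^2) * t^2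
      + 32*(1-τ)^2*(1+6*τ+2*(1-τ^2)*Nr)) * t^2 / 4
      - (-2*τ*(1+τ)^2*(1-τ-6*τ^2) * t^5
        + 4*(1-τ^2)*((1-2*τ)*(1+7*τ)+2*(1-τ)^3*(1+τ)*Nr) * t^3
        - 32*(1-τ)^2*(1+6*τ+2*(1-τ^2)*Nr) * t) * t / 2
      + 3 / 2 * (4*τ*(1-τ^2)*(1+2*τ) * t^4 - 8*(1-τ)^2*(1+6*τ+2*Nr*(1-τ^2)) * t^2)) * hI t
    + ((-2*τ*(1+τ)^2*(1-τ-6*τ^2) * t^5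
        + 4*(1-τ^2)*((1-2*τ)*(1+7*τ)+2*(1-τ)^3*(1+τ)*Nr) * t^3
        - 32*(1-τ)^2*(1+6*τ+2*(1-τ^2)*Nr) * t) * t^2 / 4
      - (4*τ*(1-τ^2)*(1+2*τ) * t^4 - 8*(1-τ)^2*(1+6*τ+2*Nr*(1-τ^2)) * t^2) * t) * hI'
    + (4*τ*(1-τ^2)*(1+2*τ) * t^4 - 8*(1-τ)^2*(1+6*τ+2*Nr*(1-τ^2)) * t^2) * t^2 / 4 * hI''
    - (4*τ*(1-τ^2)*(1+2*τ) * t^4 - 8*(1-τ)^2*(1+6*τ+2*Nr*(1-τ^2)) * t^2) * t * hS'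
    + (-6*τ^2*(1+τ)^2*(1+2*τ) * t^6
      + (8*τ*(2-τ)*(1-τ^2)^2*Nr + 16*τ*(1-τ^2)*(2+7*τ)) * t^4
      - 24*(1-τ)^2*(1+6*τ+2*Nr*(1-τ^2)) * t^2) * hS

/-- If `V` is tied to `u` by the relation `hI` and a second-order combination of `V` is
proportional to `d u`, then eliminating `u` yields the equation with coefficients `Bpoly`. -/
theorem sum_Bpoly_mul_eq_zero (hu : IsJet u) (hV : IsJet V)
    (hI : ∀ t, 4 * (t ^ 2 * V 0 t) + 4 * (1 - τ) * (t ^ 1 * u 2 t)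
      + 2 * τ * (1 + τ) * (4 - τ) * (t ^ 2 * u 1 t) - 4 * (1 - τ) * u 1 t
      + 3 * τ ^ 2 * (1 + τ) ^ 2 * (t ^ 3 * u 0 t) = 0)
    (hW : ∀ t, (pa τ Nr).eval t * V 0 t + (pb τ Nr).eval t * V 1 t + (pc τ Nr).eval t * V 2 t
      + Nr * τ ^ 2 * (1 + τ) ^ 5 * ((pd τ Nr).eval t * u 0 t) = 0) (t : ℝ) :
    ∑ k ∈ Finset.range 5, (Bpoly τ Nr k).eval t * V k t = 0 := by
  refine eq_zero_of_forall_ne_zero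
    (f := fun t => ∑ k ∈ Finset.range 5, (Bpoly τ Nr k).eval t * V k t) ?_ (fun t ht => ?_) t
  · exact continuous_finsetSum _ fun k _ => (Bpoly τ Nr k).continuous.mul (hV.continuous k)
  have hW' := fun t => HasDerivAt.eq_of_forall_eq
    ((((hV.hasDerivAt_eval_mul (pa τ Nr) 0 t).add (hV.hasDerivAt_eval_mul (pb τ Nr) 1 t)).add
      (hV.hasDerivAt_eval_mul (pc τ Nr) 2 t)).add
      ((hu.hasDerivAt_eval_mul (pd τ Nr) 0 t).const_mul _)) (hasDerivAt_const t (0 : ℝ)) hW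
  have hW'' := HasDerivAt.eq_of_forall_eq
    (((((hV.hasDerivAt_eval_mul _ 0 t).add (hV.hasDerivAt_eval_mul _ 1 t)).add
      ((hV.hasDerivAt_eval_mul _ 1 t).add (hV.hasDerivAt_eval_mul _ 2 t))).add
      ((hV.hasDerivAt_eval_mul _ 2 t).add (hV.hasDerivAt_eval_mul _ 3 t))).add
      (((hu.hasDerivAt_eval_mul _ 0 t).add (hu.hasDerivAt_eval_mul _ 1 t)).const_mul _))
    (hasDerivAt_const t (0 : ℝ)) hW'
  have hW' := hW' t
  have hW := hW t
  have hI := hI t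
  refine (mul_eq_zero.1 ?_).resolve_left (pow_ne_zero 5 ht)
  simp only [Finset.mul_sum, ← mul_assoc, pow_mul_eval_Bpoly]
  simp only [Finset.sum_range_succ, Finset.sum_range_zero, tβ, eval_add, eval_sub, eval_neg,
    eval_mul, eval_pow, eval_C, eval_X, eval_zero, zero_add, Nat.reduceAdd] at *
  have hq : (pq τ).eval t = 2 * τ * (1 + τ) * (4 - τ) * t ^ 2 - 4 * (1 - τ) := by simp [pq]
  rw [hq]
  generalize (pd τ Nr).eval t = d at *
  generalize (derivative (pd τ Nr)).eval t = d' at *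
  generalize (derivative (derivative (pd τ Nr))).eval t = d'' at *
  linear_combination 4 * (1 - τ) * t * d ^ 2 * hW''
    + ((2 * τ * (1 + τ) * (4 - τ) * t ^ 2 - 4 * (1 - τ)) * d ^ 2 - 8 * (1 - τ) * t * d * d') * hW'
    + (8 * (1 - τ) * t * d' ^ 2 - 4 * (1 - τ) * t * d * d''
      - (2 * τ * (1 + τ) * (4 - τ) * t ^ 2 - 4 * (1 - τ)) * d * d'
      + 3 * τ ^ 2 * (1 + τ) ^ 2 * t ^ 3 * d ^ 2) * hW
    - Nr * τ ^ 2 * (1 + τ) ^ 5 * d ^ 3 * hI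

end Elimination

/-- **Theorem (Fourth-order differential equation for `V`).**
For every `τ ∈ [0,1]` and every even integer `N ≥ 2`,
`B_4(t)V⁗(t) + B_3(t)V‴(t) + B_2(t)V″(t) + B_1(t)V′(t) + B_0(t)V(t) = 0` for all `t`. -/
theorem V_fourth_order_ODE (τ : ℝ) (hτ : τ ∈ Set.Icc (0:ℝ) 1)
    (N : ℕ) (hNeven : Even N) (hN2 : 2 ≤ N) (t : ℝ) :
    ∑ k ∈ Finset.range 5, (Bpoly τ (N : ℝ) k).eval t * iteratedDeriv k (VF τ N) t = 0 := by
  obtain ⟨k, rfl⟩ := Nat.exists_eq_add_of_le' hN2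
  have hτ' : 0 < 1 + τ := by linarith [hτ.1]
  have hT := transformSystem_biLaplace hτ' k
  have hV := ContDiff.isJet_iteratedDeriv (contDiff_VF hτ' k)
  have hI := VF_relation hτ' k
  exact sum_Bpoly_mul_eq_zero hT.jet_u hV hI
    (hT.combination_V (by push_cast; ring) hV hI) t
end

section
/- (Skew-orthogonal summation identity, odd–even part.) For every τ ∈ [0,1], every even integer N ≥ 2 and every x ∈ ℝ: −Σ_{k=0}^{N/2−1} Φ_{2k+1}(x)·p_{2k}(x)/(2k)! = 2(1+τ)·e^{−x²/(2(1+τ))}·Σ_{k=0}^{N/2−1} C_{2k}(x)²/(2k)!. -/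
open Real MeasureTheory Finset

/-- The skew-orthogonal polynomials of the elliptic GinOE:
`p_{2k} = C_{2k}`, `p_{2k+1} = C_{2k+1} − 2k·C_{2k−1}`. -/
noncomputable def pSO (τ : ℝ) (k : ℕ) (x : ℝ) : ℝ :=
  if k % 2 = 0 then CH τ k x else CH τ k x - ((k:ℝ)-1) * CH τ (k-2) x

/-- `Φ_k(x) = ∫_ℝ sgn(x−y)·p_k(y)·e^{−y²/(2(1+τ))} dy`. -/
noncomputable def PhiF (τ : ℝ) (k : ℕ) (x : ℝ) : ℝ :=
  ∫ y : ℝ, Real.sign (x - y) * pSO τ k y * Real.exp (-y^2/(2*(1+τ)))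

/-- A natural power times `C_k` times a centred Gaussian is integrable. -/
theorem integrable_pow_mul_CH_mul_exp (τ : ℝ) {b : ℝ} (hb : 0 < b) (k : ℕ) :
    ∀ j : ℕ, Integrable (fun y : ℝ => y ^ j * CH τ k y * Real.exp (-b * y ^ 2)) := by
  have base (j : ℕ) : Integrable (fun y : ℝ => y ^ j * Real.exp (-b * y ^ 2)) := by
    have h := integrable_rpow_mul_exp_neg_mul_sq hb (s := (j : ℝ))
      (by linarith [Nat.cast_nonneg (α := ℝ) j])
    simpa only [Real.rpow_natCast] using h
  induction k using Nat.twoStepInduction with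
  | zero => intro j; simpa [CH] using base j
  | one => intro j; simpa [CH, pow_succ] using base (j + 1)
  | more k ih₀ ih₁ =>
    intro j
    refine ((ih₁ (j + 1)).sub ((ih₀ j).const_mul (((k : ℝ) + 1) * τ))).congr (.of_forall ?_)
    intro y
    simp only [CH, Pi.sub_apply]
    ring

/-- `C_k` times the Gaussian weight is integrable. -/
theorem integrable_CH_mul_weight {τ : ℝ} (hτ : 0 < 1 + τ) (k : ℕ) :
    Integrable (fun y : ℝ => CH τ k y * Real.exp (-y ^ 2 / (2 * (1 + τ)))) := by
  refine (integrable_pow_mul_CH_mul_exp τ (b := 1 / (2 * (1 + τ))) (by positivity) k 0).congr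
    (.of_forall fun y => ?_)
  simp only [pow_zero, one_mul]
  congr 2
  ring

/-- The Appell property `C_{k+1}' = (k+1) C_k`. -/
theorem hasDerivAt_CH_succ (τ : ℝ) (k : ℕ) (y : ℝ) :
    HasDerivAt (CH τ (k + 1)) (((k : ℝ) + 1) * CH τ k y) y := by
  induction k using Nat.twoStepInduction with
  | zero => simpa [CH] using hasDerivAt_id' y
  | one =>
    refine HasDerivAt.congr_of_eventuallyEq (f := fun z => z * z - τ)
      (((hasDerivAt_id' y).mul (hasDerivAt_id' y)).sub_const τ |>.congr_deriv ?_)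
      (.of_forall fun z => ?_)
    · rw [CH]
      push_cast
      ring
    · simp [CH]
  | more k ih₀ ih₁ =>
    refine HasDerivAt.congr_deriv (f := CH τ (k + 2 + 1))
      (((hasDerivAt_id' y).mul ih₁).sub (ih₀.const_mul (((k + 1 : ℕ) + 1 : ℝ) * τ))) ?_
    have hrec : CH τ (k + 2) y = y * CH τ (k + 1) y - ((k : ℝ) + 1) * τ * CH τ k y := rfl
    have hrec' : CH τ (k + 1 + 1) y = CH τ (k + 2) y := rfl
    rw [hrec', hrec]
    push_cast
    ring

/-- The odd skew-orthogonal polynomial times the weight is an exact derivative. -/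
theorem hasDerivAt_CH_mul_weight {τ : ℝ} (hτ : 0 < 1 + τ) (k : ℕ) (y : ℝ) :
    HasDerivAt (fun z => -(1 + τ) * (CH τ (2 * k) z * Real.exp (-z ^ 2 / (2 * (1 + τ)))))
      (pSO τ (2 * k + 1) y * Real.exp (-y ^ 2 / (2 * (1 + τ)))) y := by
  have hw : HasDerivAt (fun z : ℝ => Real.exp (-z ^ 2 / (2 * (1 + τ))))
      (Real.exp (-y ^ 2 / (2 * (1 + τ))) * (-(2 * y) / (2 * (1 + τ)))) y := by
    simpa using (((hasDerivAt_pow 2 y).neg).div_const (2 * (1 + τ))).exp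
  have hodd : (2 * k + 1) % 2 ≠ 0 := by omega
  rcases k with _ | k
  · refine (hw.const_mul (-(1 + τ))).congr_deriv ?_ |>.congr_of_eventuallyEq (.of_forall ?_)
    · simp [pSO, CH]
      field_simp
      ring
    · intro z; simp [CH]
  · refine (((hasDerivAt_CH_succ τ (2 * k + 1) y).mul hw).const_mul (-(1 + τ))).congr_deriv ?_
    rw [pSO, if_neg hodd]
    have hrec : CH τ (2 * (k + 1) + 1) y
        = y * CH τ (2 * k + 2) y - ((2 * k + 1 : ℕ) + 1 : ℝ) * τ * CH τ (2 * k + 1) y := rfl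
    have hsub : 2 * (k + 1) + 1 - 2 = 2 * k + 1 := by omega
    rw [hrec, hsub]
    push_cast
    field_simp
    ring

/-- The skew-orthogonal polynomials times the weight are integrable. -/
theorem integrable_pSO_mul_weight {τ : ℝ} (hτ : 0 < 1 + τ) (k : ℕ) :
    Integrable (fun y : ℝ => pSO τ k y * Real.exp (-y ^ 2 / (2 * (1 + τ)))) := by
  by_cases hk : k % 2 = 0
  · simpa only [pSO, if_pos hk] using integrable_CH_mul_weight hτ k
  · refine ((integrable_CH_mul_weight hτ k).sub
      ((integrable_CH_mul_weight hτ (k - 2)).const_mul ((k : ℝ) - 1))).congr (.of_forall fun y => ?_)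
    simp only [pSO, if_neg hk, Pi.sub_apply]
    ring

/-- If `F` and its derivative are integrable, integrating `F'` against `sgn (x - ·)` gives
`2 F x`. -/
theorem integral_sign_sub_mul_deriv {F F' : ℝ → ℝ} (hF : ∀ y, HasDerivAt F (F' y) y)
    (hFi : Integrable F) (hF'i : Integrable F') (x : ℝ) :
    ∫ y, Real.sign (x - y) * F' y = 2 * F x := by
  have hL : ∫ y in Set.Iic x, Real.sign (x - y) * F' y = F x := by
    have hbot := tendsto_zero_of_hasDerivAt_of_integrableOn_Iic (a := x)
      (fun y _ => hF y) hF'i.integrableOn hFi.integrableOn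
    rw [integral_Iic_eq_integral_Iio,
      setIntegral_congr_fun (g := F') measurableSet_Iio fun y hy => by
        simp [Real.sign_of_pos (sub_pos.2 hy)],
      ← integral_Iic_eq_integral_Iio,
      integral_Iic_of_hasDerivAt_of_tendsto' (fun y _ => hF y) hF'i.integrableOn hbot, sub_zero]
  have hR : ∫ y in Set.Ioi x, Real.sign (x - y) * F' y = F x := by
    have htop := tendsto_zero_of_hasDerivAt_of_integrableOn_Ioi (a := x)
      (fun y _ => hF y) hF'i.integrableOn hFi.integrableOn
    rw [setIntegral_congr_fun (g := fun y => -F' y) measurableSet_Ioi fun y hy => by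
        simp [Real.sign_of_neg (sub_neg.2 hy)],
      integral_neg,
      integral_Ioi_of_hasDerivAt_of_tendsto' (fun y _ => hF y) hF'i.integrableOn htop]
    ring
  have hi : Integrable (fun y => Real.sign (x - y) * F' y) := by
    have hs : Measurable Real.sign :=
      Measurable.ite measurableSet_Iio measurable_const
        (Measurable.ite measurableSet_Ioi measurable_const measurable_const)
    refine hF'i.bdd_mul (c := 1)
      (hs.comp (measurable_const.sub measurable_id)).aestronglyMeasurable (.of_forall fun y => ?_)
    rcases Real.sign_apply_eq (x - y) with h | h | h <;> simp [h]
  rw [← intervalIntegral.integral_Iic_add_Ioi hi.integrableOn hi.integrableOn, hL, hR]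
  ring

/-- Closed form `Φ_{2k+1} = -2(1+τ) C_{2k} e^{-x²/(2(1+τ))}`. -/
theorem PhiF_odd {τ : ℝ} (hτ : 0 < 1 + τ) (k : ℕ) (x : ℝ) :
    PhiF τ (2 * k + 1) x
      = -(2 * (1 + τ)) * (CH τ (2 * k) x * Real.exp (-x ^ 2 / (2 * (1 + τ)))) := by
  have h := integral_sign_sub_mul_deriv (hasDerivAt_CH_mul_weight hτ k)
    ((integrable_CH_mul_weight hτ (2 * k)).const_mul _)
    (integrable_pSO_mul_weight hτ (2 * k + 1)) x
  simp only [PhiF, mul_assoc] at h ⊢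
  rw [h]
  ring

/-- **Theorem (Skew-orthogonal summation identity, odd–even part).**
`−Σ_{k=0}^{N/2−1} Φ_{2k+1}(x)·p_{2k}(x)/(2k)! = 2(1+τ)·e^{−x²/(2(1+τ))}·
Σ_{k=0}^{N/2−1} C_{2k}(x)²/(2k)!`. -/
theorem skew_orthogonal_sum_odd_even (τ : ℝ) (hτ : τ ∈ Set.Icc (0:ℝ) 1)
    (N : ℕ) (hNeven : Even N) (hN2 : 2 ≤ N) (x : ℝ) :
    -∑ k ∈ Finset.range (N/2), PhiF τ (2*k+1) x * pSO τ (2*k) x / (Nat.factorial (2*k) : ℝ)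
      = 2*(1+τ) * Real.exp (-x^2/(2*(1+τ))) *
          ∑ k ∈ Finset.range (N/2), (CH τ (2*k) x)^2 / (Nat.factorial (2*k) : ℝ) := by
  have hτ' : 0 < 1 + τ := by linarith [hτ.1]
  rw [mul_sum, ← sum_neg_distrib]
  refine sum_congr rfl fun k _ => ?_
  rw [PhiF_odd hτ', pSO, if_pos (by omega)]
  ring
end
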